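/- (Monotonicity and discrete maximum principle for the second-order scheme.) Assume Δx·max_{i,j}|u_{i,j}| ≤ 2μ and Δy·max_{i,j}|v_{i,j}| ≤ 2μ. Then the second-order scheme operator L is bijective, its inverse maps entrywise-nonnegative arrays to entrywise-nonnegative arrays, and the discrete maximum principle holds: whenever Lφ = b, every entry of φ satisfies min_{(k,l)} b_{k,l} ≤ φ_{i,j} ≤ max_{(k,l)} b_{k,l}, where the min and max are over all grid indices. -/

import Mathlib

/-- The value of a grid array at a pair of natural indices (`0` outside the grid;
inside the grid all index arithmetic of the scheme stays in range). -/
noncomputable def gridVal (nx ny : ℕ) (φ : Fin (nx + 2) → Fin (ny + 2) → ℝ)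
    (i j : ℕ) : ℝ :=
  if hi : i < nx + 2 then if hj : j < ny + 2 then φ ⟨i, hi⟩ ⟨j, hj⟩ else 0 else 0

/-- `(i,j)` is a boundary index of the `(nx+2) × (ny+2)` grid. -/
def isBdry (nx ny i j : ℕ) : Prop := i = 0 ∨ i = nx + 1 ∨ j = 0 ∨ j = ny + 1

instance (nx ny i j : ℕ) : Decidable (isBdry nx ny i j) := by
  unfold isBdry; infer_instance

/-- The second-order scheme operator `L` for the backward-Euler step of the
convection-diffusion equation: `(Lφ)ᵢⱼ = φᵢⱼ` at boundary indices, and at interior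
indices the classical centered second-order finite difference discretization of
`φ + Δt(u∂ₓφ + v∂_yφ - μΔφ)`. -/
noncomputable def schemeL2nd (nx ny : ℕ) (Δx Δy μ Δt : ℝ) (u v : ℕ → ℕ → ℝ)
    (φ : Fin (nx + 2) → Fin (ny + 2) → ℝ) (I : Fin (nx + 2)) (J : Fin (ny + 2)) : ℝ :=
  let i := (I : ℕ)
  let j := (J : ℕ)
  let ψ := gridVal nx ny φ
  if isBdry nx ny i j then φ I J
  else
    ψ i j + Δt * u i j * (ψ (i + 1) j - ψ (i - 1) j) / (2 * Δx)
      + Δt * v i j * (ψ i (j + 1) - ψ i (j - 1)) / (2 * Δy)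
      + Δt * μ * (-ψ (i - 1) j + 2 * ψ i j - ψ (i + 1) j) / Δx ^ 2
      + Δt * μ * (-ψ i (j - 1) + 2 * ψ i j - ψ i (j + 1)) / Δy ^ 2

lemma gridVal_coe (nx ny : ℕ) (φ : Fin (nx + 2) → Fin (ny + 2) → ℝ)
    (I : Fin (nx + 2)) (J : Fin (ny + 2)) : gridVal nx ny φ I J = φ I J := by
  simp [gridVal]

lemma gridVal_add (nx ny : ℕ) (φ χ : Fin (nx + 2) → Fin (ny + 2) → ℝ) (i j : ℕ) :
    gridVal nx ny (φ + χ) i j = gridVal nx ny φ i j + gridVal nx ny χ i j := by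
  unfold gridVal
  split_ifs <;> simp

lemma gridVal_smul (nx ny : ℕ) (c : ℝ) (φ : Fin (nx + 2) → Fin (ny + 2) → ℝ) (i j : ℕ) :
    gridVal nx ny (c • φ) i j = c * gridVal nx ny φ i j := by
  unfold gridVal
  split_ifs <;> simp

lemma le_gridVal {nx ny : ℕ} {φ : Fin (nx + 2) → Fin (ny + 2) → ℝ} {m : ℝ}
    (hm : ∀ I J, m ≤ φ I J) {i j : ℕ} (hi : i < nx + 2) (hj : j < ny + 2) :
    m ≤ gridVal nx ny φ i j := by
  simp [gridVal, hi, hj, hm]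

/-- The second-order scheme operator as a linear map. -/
noncomputable def schemeL2ndLinear (nx ny : ℕ) (Δx Δy μ Δt : ℝ) (u v : ℕ → ℕ → ℝ) :
    (Fin (nx + 2) → Fin (ny + 2) → ℝ) →ₗ[ℝ] (Fin (nx + 2) → Fin (ny + 2) → ℝ) where
  toFun := schemeL2nd nx ny Δx Δy μ Δt u v
  map_add' φ χ := by
    ext I J
    simp only [schemeL2nd, gridVal_add, Pi.add_apply]
    split_ifs
    · rfl
    · ring
  map_smul' c φ := by
    ext I J
    simp only [schemeL2nd, gridVal_smul, Pi.smul_apply, smul_eq_mul, RingHom.id_apply]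
    split_ifs
    · rfl
    · ring

/-- Under the mesh condition `h * |w| ≤ 2 * μ`, the one-dimensional centered
convection-diffusion stencil is nonpositive at a local minimum. -/
lemma centered_stencil_nonpos {h μ Δt w a b c : ℝ} (hh : 0 < h) (hΔt : 0 < Δt)
    (hw : h * |w| ≤ 2 * μ) (ha : c ≤ a) (hb : c ≤ b) :
    Δt * w * (b - a) / (2 * h) + Δt * μ * (-a + 2 * c - b) / h ^ 2 ≤ 0 := by
  have key : Δt * w * (b - a) / (2 * h) + Δt * μ * (-a + 2 * c - b) / h ^ 2
      = -(Δt / (2 * h ^ 2) * ((b - c) * (2 * μ - h * w) + (a - c) * (2 * μ + h * w))) := by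
    field_simp
    ring
  have h1 : 0 ≤ 2 * μ - h * w := by nlinarith [le_abs_self w]
  have h2 : 0 ≤ 2 * μ + h * w := by nlinarith [neg_abs_le w]
  have h3 : 0 ≤ b - c := sub_nonneg.2 hb
  have h4 : 0 ≤ a - c := sub_nonneg.2 ha
  rw [key, neg_nonpos]
  positivity

section MeshCondition

variable {nx ny : ℕ} {Δx Δy μ Δt : ℝ} {u v : ℕ → ℕ → ℝ}

/-- At a global minimum of `φ`, the scheme operator does not exceed `φ`. -/
lemma schemeL2nd_le_of_forall_ge (hΔx : 0 < Δx) (hΔy : 0 < Δy) (hΔt : 0 < Δt)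
    (huv : ∀ i j : ℕ, 1 ≤ i → i ≤ nx → 1 ≤ j → j ≤ ny →
      Δx * |u i j| ≤ 2 * μ ∧ Δy * |v i j| ≤ 2 * μ)
    {φ : Fin (nx + 2) → Fin (ny + 2) → ℝ} {I : Fin (nx + 2)} {J : Fin (ny + 2)}
    (hmin : ∀ K M, φ I J ≤ φ K M) :
    schemeL2nd nx ny Δx Δy μ Δt u v φ I J ≤ φ I J := by
  have hI := I.isLt
  have hJ := J.isLt
  by_cases hb : isBdry nx ny I J
  · simp [schemeL2nd, hb]
  simp only [schemeL2nd, hb, if_false, gridVal_coe]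
  simp only [isBdry, not_or] at hb
  obtain ⟨hu, hv⟩ := huv I J (by omega) (by omega) (by omega) (by omega)
  have hx := centered_stencil_nonpos hΔx hΔt hu
    (le_gridVal hmin (i := I - 1) (j := J) (by omega) hJ)
    (le_gridVal hmin (i := I + 1) (j := J) (by omega) hJ)
  have hy := centered_stencil_nonpos hΔy hΔt hv
    (le_gridVal hmin (i := I) (j := J - 1) hI (by omega))
    (le_gridVal hmin (i := I) (j := J + 1) hI (by omega))
  linarith

/-- Every lower bound of `Lφ` is a lower bound of `φ`. -/
lemma le_of_le_schemeL2nd (hΔx : 0 < Δx) (hΔy : 0 < Δy) (hΔt : 0 < Δt)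
    (huv : ∀ i j : ℕ, 1 ≤ i → i ≤ nx → 1 ≤ j → j ≤ ny →
      Δx * |u i j| ≤ 2 * μ ∧ Δy * |v i j| ≤ 2 * μ)
    {φ : Fin (nx + 2) → Fin (ny + 2) → ℝ} {m : ℝ}
    (hm : ∀ I J, m ≤ schemeL2nd nx ny Δx Δy μ Δt u v φ I J)
    (I : Fin (nx + 2)) (J : Fin (ny + 2)) : m ≤ φ I J := by
  obtain ⟨p, hp⟩ := Finite.exists_min
    (fun p : Fin (nx + 2) × Fin (ny + 2) => φ p.1 p.2)
  calc m ≤ schemeL2nd nx ny Δx Δy μ Δt u v φ p.1 p.2 := hm _ _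
    _ ≤ φ p.1 p.2 := schemeL2nd_le_of_forall_ge hΔx hΔy hΔt huv fun K M => hp (K, M)
    _ ≤ φ I J := hp (I, J)

/-- Every upper bound of `Lφ` is an upper bound of `φ`. -/
lemma le_of_schemeL2nd_le (hΔx : 0 < Δx) (hΔy : 0 < Δy) (hΔt : 0 < Δt)
    (huv : ∀ i j : ℕ, 1 ≤ i → i ≤ nx → 1 ≤ j → j ≤ ny →
      Δx * |u i j| ≤ 2 * μ ∧ Δy * |v i j| ≤ 2 * μ)
    {φ : Fin (nx + 2) → Fin (ny + 2) → ℝ} {m : ℝ}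
    (hm : ∀ I J, schemeL2nd nx ny Δx Δy μ Δt u v φ I J ≤ m)
    (I : Fin (nx + 2)) (J : Fin (ny + 2)) : φ I J ≤ m := by
  have hneg : schemeL2nd nx ny Δx Δy μ Δt u v (-φ) = -schemeL2nd nx ny Δx Δy μ Δt u v φ :=
    map_neg (schemeL2ndLinear nx ny Δx Δy μ Δt u v) φ
  refine neg_le_neg_iff.1 (le_of_le_schemeL2nd hΔx hΔy hΔt huv (φ := -φ) (m := -m) ?_ I J)
  intro K M
  rw [hneg]
  exact neg_le_neg (hm K M)

lemma schemeL2nd_bijective (hΔx : 0 < Δx) (hΔy : 0 < Δy) (hΔt : 0 < Δt)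
    (huv : ∀ i j : ℕ, 1 ≤ i → i ≤ nx → 1 ≤ j → j ≤ ny →
      Δx * |u i j| ≤ 2 * μ ∧ Δy * |v i j| ≤ 2 * μ) :
    Function.Bijective (schemeL2nd nx ny Δx Δy μ Δt u v) := by
  have hinj : Function.Injective (schemeL2ndLinear nx ny Δx Δy μ Δt u v) := by
    refine (injective_iff_map_eq_zero _).2 fun φ hφ => ?_
    have hzero : ∀ I J, schemeL2nd nx ny Δx Δy μ Δt u v φ I J = 0 :=
      fun I J => congrFun (congrFun hφ I) J
    ext I J
    exact le_antisymm
      (le_of_schemeL2nd_le hΔx hΔy hΔt huv (fun K M => (hzero K M).le) I J)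
      (le_of_le_schemeL2nd hΔx hΔy hΔt huv (fun K M => (hzero K M).ge) I J)
  exact ⟨hinj, LinearMap.injective_iff_surjective.1 hinj⟩

end MeshCondition

/-- Theorem 3.5 in the paper (monotonicity and discrete maximum principle for the
second-order scheme): if `Δx·maxᵢⱼ|uᵢⱼ| ≤ 2μ` and `Δy·maxᵢⱼ|vᵢⱼ| ≤ 2μ`, then the
second-order scheme operator `L` is bijective, its inverse maps entrywise-nonnegative
arrays to entrywise-nonnegative arrays, and whenever `Lφ = b` every entry of `φ` lies
between the minimal and the maximal entry of `b`. -/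
theorem schemeL2nd_monotone_and_dmp
    (nx ny : ℕ) (hnx : 1 ≤ nx) (hny : 1 ≤ ny)
    (Δx Δy μ Δt : ℝ) (hΔx : 0 < Δx) (hΔy : 0 < Δy) (hμ : 0 < μ) (hΔt : 0 < Δt)
    (u v : ℕ → ℕ → ℝ)
    (huv : ∀ i j : ℕ, 1 ≤ i → i ≤ nx → 1 ≤ j → j ≤ ny →
      Δx * |u i j| ≤ 2 * μ ∧ Δy * |v i j| ≤ 2 * μ) :
    Function.Bijective (schemeL2nd nx ny Δx Δy μ Δt u v) ∧
      (∀ φ : Fin (nx + 2) → Fin (ny + 2) → ℝ,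
        (∀ I J, 0 ≤ schemeL2nd nx ny Δx Δy μ Δt u v φ I J) → ∀ I J, 0 ≤ φ I J) ∧
      ∀ (φ b : Fin (nx + 2) → Fin (ny + 2) → ℝ),
        (∀ I J, schemeL2nd nx ny Δx Δy μ Δt u v φ I J = b I J) →
        ∀ I J,
          Finset.univ.inf' ⟨((0 : Fin (nx + 2)), (0 : Fin (ny + 2))), Finset.mem_univ _⟩
              (fun p => b p.1 p.2) ≤ φ I J ∧
            φ I J ≤
              Finset.univ.sup' ⟨((0 : Fin (nx + 2)), (0 : Fin (ny + 2))), Finset.mem_univ _⟩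
                (fun p => b p.1 p.2) := by
  refine ⟨schemeL2nd_bijective hΔx hΔy hΔt huv,
    fun φ hφ => le_of_le_schemeL2nd hΔx hΔy hΔt huv hφ, fun φ b hb I J => ⟨?_, ?_⟩⟩
  · refine le_of_le_schemeL2nd hΔx hΔy hΔt huv (fun K M => ?_) I J
    rw [hb]
    exact Finset.inf'_le (fun p : Fin (nx + 2) × Fin (ny + 2) => b p.1 p.2)
      (Finset.mem_univ (K, M))
  · refine le_of_schemeL2nd_le hΔx hΔy hΔt huv (fun K M => ?_) I J
    rw [hb]
    exact Finset.le_sup' (fun p : Fin (nx + 2) × Fin (ny + 2) => b p.1 p.2)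
      (Finset.mem_univ (K, M))
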